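/- Let J ≥ 1, let a_1,…,a_{J+1} be positive integers, and let s_1,…,s_J be positive integers with s_j ≤ a_j·a_{j+1} for each j. Define D = {D_J⋯D_2D_1 : D_j ∈ ℝ^{a_{j+1}×a_j}, ‖D_j‖_0 ≤ s_j, ‖D_j‖_F = 1 for all j} ⊆ ℝ^{a_{J+1}×a_1}. Then for every ε > 0 there exists a finite set F ⊆ ℝ^{a_{J+1}×a_1} with cardinality |F| ≤ Π_{j=1}^J C(a_j·a_{j+1}, s_j)·(1 + 2J/ε)^{s_j} (where C(n,k) denotes the binomial coefficient) such that every element of D is within Frobenius distance ε of some element of F. -/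

import Mathlib

noncomputable def frobNorm {p q : ℕ} (A : Matrix (Fin p) (Fin q) ℝ) : ℝ :=
  Real.sqrt (∑ i, ∑ j, A i j ^ 2)

open Classical in
noncomputable def l0 {p q : ℕ} (A : Matrix (Fin p) (Fin q) ℝ) : ℕ :=
  (Finset.univ.filter fun ij : Fin p × Fin q => A ij.1 ij.2 ≠ 0).card

/-- `chainProd a J D = D (J-1) * ⋯ * D 1 * D 0`, the product of the first `J`
matrices of the chain `D`, where `D j` has size `a (j+1) × a j`. -/
noncomputable def chainProd (a : ℕ → ℕ) :
    (J : ℕ) → (∀ j : ℕ, Matrix (Fin (a (j + 1))) (Fin (a j)) ℝ) →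
      Matrix (Fin (a J)) (Fin (a 0)) ℝ
  | 0, _ => 1
  | J + 1, D => D J * chainProd a J D

open MeasureTheory Metric Module

open scoped ENNReal

/-- A `δ`-separated finite subset of the unit ball of a `d`-dimensional real normed space has at
most `(1 + 2 / δ) ^ d` elements. -/
theorem card_le_of_separated_unitBall {E : Type*} [NormedAddCommGroup E] [NormedSpace ℝ E]
    [FiniteDimensional ℝ E] {δ : ℝ} (hδ : 0 < δ) {t : Finset E} (ht : ∀ c ∈ t, ‖c‖ ≤ 1)
    (hsep : ∀ c ∈ t, ∀ d ∈ t, c ≠ d → δ ≤ ‖c - d‖) :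
    (t.card : ℝ) ≤ (1 + 2 / δ) ^ finrank ℝ E := by
  borelize E
  let μ : Measure E := Measure.addHaar
  have hr : 0 < δ / 2 := by positivity
  have hR : 0 < 1 + δ / 2 := by positivity
  have hdisj : Set.Pairwise (t : Set E) (Function.onFun Disjoint fun c ↦ ball c (δ / 2)) := by
    rintro c hc d hd hcd
    apply ball_disjoint_ball
    rw [dist_eq_norm]
    linarith [hsep c hc d hd hcd]
  have hsub : ⋃ c ∈ t, ball c (δ / 2) ⊆ ball (0 : E) (1 + δ / 2) := by
    refine Set.iUnion₂_subset fun c hc ↦ ball_subset_ball' ?_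
    rw [dist_zero_right]
    linarith [ht c hc]
  have hvol : (t.card : ℝ≥0∞) * ENNReal.ofReal ((δ / 2) ^ finrank ℝ E) * μ (ball 0 1) ≤
      ENNReal.ofReal ((1 + δ / 2) ^ finrank ℝ E) * μ (ball 0 1) :=
    calc
      _ = μ (⋃ c ∈ t, ball c (δ / 2)) := by
        rw [measure_biUnion_finset hdisj fun c _ ↦ measurableSet_ball]
        simp only [μ.addHaar_ball_of_pos _ hr, Finset.sum_const, nsmul_eq_mul, mul_assoc]
      _ ≤ μ (ball (0 : E) (1 + δ / 2)) := measure_mono hsub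
      _ = _ := μ.addHaar_ball_of_pos _ hR
  have hcard := (ENNReal.mul_le_mul_iff_left (measure_ball_pos _ _ zero_lt_one).ne'
    measure_ball_lt_top.ne).1 hvol
  have hreal : (t.card : ℝ) * (δ / 2) ^ finrank ℝ E ≤ (1 + δ / 2) ^ finrank ℝ E := by
    have := ENNReal.toReal_le_of_le_ofReal (pow_nonneg hR.le _) hcard
    rwa [ENNReal.toReal_mul, ENNReal.toReal_natCast,
      ENNReal.toReal_ofReal (pow_nonneg hr.le _)] at this
  rw [← le_div_iff₀ (pow_pos hr _), ← div_pow] at hreal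
  have hratio : (1 + δ / 2) / (δ / 2) = 1 + 2 / δ := by
    field_simp
    ring
  rwa [hratio] at hreal

/-- The closed unit ball of a `d`-dimensional real normed space has a `δ`-net contained in it with
at most `(1 + 2 / δ) ^ d` elements. -/
theorem exists_net_unitBall (E : Type*) [NormedAddCommGroup E] [NormedSpace ℝ E]
    [FiniteDimensional ℝ E] {δ : ℝ} (hδ : 0 < δ) :
    ∃ t : Finset E, (t.card : ℝ) ≤ (1 + 2 / δ) ^ finrank ℝ E ∧ (∀ c ∈ t, ‖c‖ ≤ 1) ∧
      ∀ x : E, ‖x‖ ≤ 1 → ∃ c ∈ t, ‖x - c‖ ≤ δ := by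
  classical
  let S : Set ℕ := {n | ∃ t : Finset E, t.card = n ∧ (∀ c ∈ t, ‖c‖ ≤ 1) ∧
    ∀ c ∈ t, ∀ d ∈ t, c ≠ d → δ ≤ ‖c - d‖}
  have hbdd : BddAbove S := by
    refine ⟨⌊(1 + 2 / δ) ^ finrank ℝ E⌋₊, ?_⟩
    rintro _ ⟨t, rfl, ht, hsep⟩
    exact Nat.le_floor (card_le_of_separated_unitBall hδ ht hsep)
  have hne : S.Nonempty := ⟨0, ∅, by simp⟩
  obtain ⟨t, htcard, ht, hsep⟩ := Nat.sSup_mem hne hbdd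
  refine ⟨t, card_le_of_separated_unitBall hδ ht hsep, ht, fun x hx ↦ ?_⟩
  by_contra! hfar
  have hxt : x ∉ t := fun h ↦ by
    have := hfar x h
    simp only [sub_self, norm_zero] at this
    linarith
  have hmem : (insert x t).card ∈ S := by
    refine ⟨insert x t, rfl, ?_, ?_⟩
    · simpa [hx] using ht
    · intro c hc d hd hcd
      rw [Finset.mem_insert] at hc hd
      rcases hc with rfl | hc <;> rcases hd with rfl | hd
      · exact absurd rfl hcd
      · exact (hfar d hd).le
      · rw [norm_sub_rev]
        exact (hfar c hc).le
      · exact hsep c hc d hd hcd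
  have := le_csSup hbdd hmem
  rw [Finset.card_insert_of_notMem hxt] at this
  omega

section Frobenius

open scoped Matrix.Norms.Frobenius

theorem frobNorm_eq_norm {p q : ℕ} (A : Matrix (Fin p) (Fin q) ℝ) : frobNorm A = ‖A‖ := by
  simp [frobNorm, Matrix.frobenius_norm_def, Real.sqrt_eq_rpow]

theorem frobNorm_mul_le {p q r : ℕ} (A : Matrix (Fin p) (Fin q) ℝ) (B : Matrix (Fin q) (Fin r) ℝ) :
    frobNorm (A * B) ≤ frobNorm A * frobNorm B := by
  simpa only [frobNorm_eq_norm] using Matrix.frobenius_norm_mul A B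

theorem frobNorm_add_le {p q : ℕ} (A B : Matrix (Fin p) (Fin q) ℝ) :
    frobNorm (A + B) ≤ frobNorm A + frobNorm B := by
  simpa only [frobNorm_eq_norm] using norm_add_le A B

end Frobenius

theorem frobNorm_nonneg {p q : ℕ} (A : Matrix (Fin p) (Fin q) ℝ) : 0 ≤ frobNorm A :=
  Real.sqrt_nonneg _

open Classical in
/-- The matrix whose entries on `T` are the coordinates of `x` and whose other entries vanish. -/
noncomputable def matrixOfSupport {p q : ℕ} (T : Finset (Fin p × Fin q))
    (x : EuclideanSpace ℝ T) : Matrix (Fin p) (Fin q) ℝ :=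
  Matrix.of fun i j ↦ if h : (i, j) ∈ T then x ⟨(i, j), h⟩ else 0

theorem frobNorm_matrixOfSupport {p q : ℕ} (T : Finset (Fin p × Fin q))
    (x : EuclideanSpace ℝ T) : frobNorm (matrixOfSupport T x) = ‖x‖ := by
  classical
  rw [frobNorm, EuclideanSpace.norm_eq, ← Fintype.sum_prod_type',
    ← Finset.sum_subset (Finset.subset_univ T), ← Finset.sum_coe_sort T]
  · congr 1
    refine Finset.sum_congr rfl fun ij _ ↦ ?_
    simp [matrixOfSupport]
  · intro ij _ hij
    simp [matrixOfSupport, hij]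

theorem matrixOfSupport_sub {p q : ℕ} (T : Finset (Fin p × Fin q))
    (x y : EuclideanSpace ℝ T) :
    matrixOfSupport T (x - y) = matrixOfSupport T x - matrixOfSupport T y := by
  ext i j
  by_cases h : (i, j) ∈ T <;> simp [matrixOfSupport, h]

theorem exists_matrixOfSupport_eq {p q : ℕ} {T : Finset (Fin p × Fin q)}
    {A : Matrix (Fin p) (Fin q) ℝ} (hA : ∀ i j, A i j ≠ 0 → (i, j) ∈ T) :
    ∃ x, matrixOfSupport T x = A := by
  refine ⟨WithLp.toLp 2 fun ij ↦ A ij.1.1 ij.1.2, ?_⟩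
  ext i j
  by_cases h : (i, j) ∈ T
  · simp [matrixOfSupport, h]
  · simpa [matrixOfSupport, h] using (not_imp_comm.1 (hA i j) h).symm

/-- Matrices in the Frobenius unit ball with at most `s` non-zero entries have a `δ`-net of at most
`C(pq, s) (1 + 2 / δ) ^ s` elements of the Frobenius unit ball. -/
theorem exists_net_sparse {p q s : ℕ} (hs : s ≤ q * p) {δ : ℝ} (hδ : 0 < δ) :
    ∃ N : Finset (Matrix (Fin p) (Fin q) ℝ),
      (N.card : ℝ) ≤ (Nat.choose (q * p) s : ℝ) * (1 + 2 / δ) ^ s ∧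
      (∀ B ∈ N, frobNorm B ≤ 1) ∧
      ∀ A : Matrix (Fin p) (Fin q) ℝ, l0 A ≤ s → frobNorm A ≤ 1 →
        ∃ B ∈ N, frobNorm (A - B) ≤ δ := by
  classical
  choose t htcard htball htnet using fun T : Finset (Fin p × Fin q) ↦
    exists_net_unitBall (EuclideanSpace ℝ T) hδ
  have hcard : (Finset.univ : Finset (Fin p × Fin q)).card = q * p := by simp [mul_comm]
  refine ⟨(Finset.powersetCard s Finset.univ).biUnion fun T ↦ (t T).image (matrixOfSupport T),
    ?_, ?_, ?_⟩
  · calc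
      _ ≤ ((∑ T ∈ Finset.powersetCard s Finset.univ,
            ((t T).image (matrixOfSupport T)).card : ℕ) : ℝ) := mod_cast Finset.card_biUnion_le
      _ ≤ ∑ T ∈ Finset.powersetCard s (Finset.univ : Finset (Fin p × Fin q)),
            (1 + 2 / δ) ^ s := by
        push_cast
        refine Finset.sum_le_sum fun T hT ↦ ?_
        have hT' := htcard T
        rw [finrank_euclideanSpace, Fintype.card_coe, (Finset.mem_powersetCard.1 hT).2] at hT'
        exact le_trans (mod_cast Finset.card_image_le) hT'
      _ = _ := by rw [Finset.sum_const, Finset.card_powersetCard, hcard, nsmul_eq_mul]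
  · intro B hB
    obtain ⟨T, -, hB⟩ := Finset.mem_biUnion.1 hB
    obtain ⟨x, hx, rfl⟩ := Finset.mem_image.1 hB
    rw [frobNorm_matrixOfSupport]
    exact htball T x hx
  · intro A hA hA1
    obtain ⟨T, hAT, -, hT⟩ := Finset.exists_subsuperset_card_eq
      (Finset.subset_univ _) hA (hs.trans_eq hcard.symm)
    obtain ⟨x, rfl⟩ := exists_matrixOfSupport_eq (T := T) (A := A)
      fun i j hij ↦ hAT (by simpa using hij)
    rw [frobNorm_matrixOfSupport] at hA1
    obtain ⟨c, hc, hxc⟩ := htnet T x hA1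
    refine ⟨matrixOfSupport T c, Finset.mem_biUnion.2
      ⟨T, by simpa [Finset.mem_powersetCard] using hT, Finset.mem_image_of_mem _ hc⟩, ?_⟩
    rwa [← matrixOfSupport_sub, frobNorm_matrixOfSupport]

theorem frobNorm_mul_sub_mul_le {p q r : ℕ} {A B : Matrix (Fin p) (Fin q) ℝ}
    {C D : Matrix (Fin q) (Fin r) ℝ} (hA : frobNorm A ≤ 1) (hD : frobNorm D ≤ 1) :
    frobNorm (A * C - B * D) ≤ frobNorm (C - D) + frobNorm (A - B) := by
  have hsplit : A * C - B * D = A * (C - D) + (A - B) * D := by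
    rw [Matrix.mul_sub, Matrix.sub_mul]
    abel
  rw [hsplit]
  refine (frobNorm_add_le _ _).trans (add_le_add ?_ ?_)
  · exact (frobNorm_mul_le _ _).trans (mul_le_of_le_one_left (frobNorm_nonneg _) hA)
  · exact (frobNorm_mul_le _ _).trans (mul_le_of_le_one_right (frobNorm_nonneg _) hD)

/-- The products of `J ≥ 1` sparse factors with unit Frobenius norm have a `J * δ`-net, contained
in the Frobenius unit ball, obtained by multiplying the elements of `δ`-nets for the factors. -/
theorem exists_net_chainProd (a s : ℕ → ℕ) {δ : ℝ} (hδ : 0 < δ) (J : ℕ) (hJ : 1 ≤ J)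
    (hs : ∀ j < J, s j ≤ a j * a (j + 1)) :
    ∃ F : Finset (Matrix (Fin (a J)) (Fin (a 0)) ℝ),
      (F.card : ℝ) ≤
        ∏ j ∈ Finset.range J,
          (Nat.choose (a j * a (j + 1)) (s j) : ℝ) * (1 + 2 / δ) ^ (s j) ∧
      (∀ B ∈ F, frobNorm B ≤ 1) ∧
      ∀ D : ∀ j : ℕ, Matrix (Fin (a (j + 1))) (Fin (a j)) ℝ,
        (∀ j < J, l0 (D j) ≤ s j ∧ frobNorm (D j) = 1) →
        ∃ B ∈ F, frobNorm (chainProd a J D - B) ≤ J * δ := by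
  classical
  induction J, hJ using Nat.le_induction with
  | base =>
    obtain ⟨N, hcard, hball, hnet⟩ := exists_net_sparse (hs 0 one_pos) hδ
    refine ⟨N, by simpa using hcard, hball, fun D hD ↦ ?_⟩
    obtain ⟨hl, hn⟩ := hD 0 one_pos
    simpa [chainProd] using hnet (D 0) hl hn.le
  | succ J _ ih =>
    obtain ⟨F, hFcard, hFball, hFnet⟩ := ih fun j hj ↦ hs j (hj.trans J.lt_succ_self)
    obtain ⟨N, hNcard, hNball, hNnet⟩ := exists_net_sparse (hs J J.lt_succ_self) hδ
    refine ⟨Finset.image₂ (· * ·) N F, ?_, ?_, fun D hD ↦ ?_⟩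
    · rw [Finset.prod_range_succ, mul_comm]
      calc
        _ ≤ ((N.card * F.card : ℕ) : ℝ) := mod_cast Finset.card_image₂_le _ _ _
        _ ≤ _ := by
          push_cast
          gcongr
    · intro B hB
      obtain ⟨A, hA, C, hC, rfl⟩ := Finset.mem_image₂.1 hB
      exact (frobNorm_mul_le A C).trans
        (mul_le_one₀ (hNball A hA) (frobNorm_nonneg C) (hFball C hC))
    · obtain ⟨hl, hn⟩ := hD J J.lt_succ_self
      obtain ⟨A, hA, hDA⟩ := hNnet (D J) hl hn.le
      obtain ⟨C, hC, hDC⟩ := hFnet D fun j hj ↦ hD j (hj.trans J.lt_succ_self)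
      refine ⟨A * C, Finset.mem_image₂_of_mem hA hC, ?_⟩
      refine (frobNorm_mul_sub_mul_le hn.le (hFball C hC)).trans ?_
      push_cast
      linarith

/-- The set of products of `J` sparse unit-Frobenius-norm factors admits, for every
`ε > 0`, an `ε`-net of cardinality at most `Π_j C(a_j·a_{j+1}, s_j)(1 + 2J/ε)^{s_j}`. -/
theorem covering_number_multilayer_sparse_products
    (J : ℕ) (hJ : 1 ≤ J) (a : ℕ → ℕ) (ha : ∀ j, 0 < a j)
    (s : ℕ → ℕ) (hs : ∀ j < J, 0 < s j ∧ s j ≤ a j * a (j + 1))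
    (ε : ℝ) (hε : 0 < ε) :
    ∃ F : Finset (Matrix (Fin (a J)) (Fin (a 0)) ℝ),
      (F.card : ℝ) ≤
        ∏ j ∈ Finset.range J,
          (Nat.choose (a j * a (j + 1)) (s j) : ℝ) * (1 + 2 * J / ε) ^ (s j) ∧
      ∀ D : ∀ j : ℕ, Matrix (Fin (a (j + 1))) (Fin (a j)) ℝ,
        (∀ j < J, l0 (D j) ≤ s j ∧ frobNorm (D j) = 1) →
        ∃ B ∈ F, frobNorm (chainProd a J D - B) ≤ ε := by
  have hJpos : (0 : ℝ) < J := mod_cast hJ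
  obtain ⟨F, hcard, -, hnet⟩ :=
    exists_net_chainProd a s (div_pos hε hJpos) J hJ fun j hj ↦ (hs j hj).2
  refine ⟨F, ?_, ?_⟩
  · simpa only [div_div_eq_mul_div] using hcard
  · simpa only [mul_div_cancel₀ ε hJpos.ne'] using hnet
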